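/- Every generalized trapezoidal word w with |Alph(w)| = 2 (i.e., every binary trapezoidal word) is rich: it contains exactly |w| + 1 distinct palindromic factors (including the empty word). -/

import Mathlib

open List

variable {A : Type*} [DecidableEq A]

/-- The alphabet of a word: the finite set of distinct letters occurring in it. -/
def Alph (w : List A) : Finset A := w.toFinset

/-- The finset of all factors (contiguous subwords) of `w`. -/
def factors (w : List A) : Finset (List A) :=
  ((Finset.range (w.length + 1)) ×ˢ (Finset.range (w.length + 1))).image
    (fun p => (w.drop p.1).take p.2)

/-- Factor complexity: the number of distinct factors of `w` of length `n`. -/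
def C (w : List A) (n : ℕ) : ℕ := ((factors w).filter (fun u => u.length = n)).card

/-- Right-valence of `u` in `w`: the number of distinct letters `x` such that `u ++ [x]`
is a factor of `w`. -/
def rightValence (w u : List A) : ℕ := ((Alph w).filter (fun x => u ++ [x] <:+: w)).card

/-- `u` is a right special factor of `w`. -/
def RightSpecial (w u : List A) : Prop := u <:+: w ∧ 2 ≤ rightValence w u

/-- `R w`: the smallest positive integer `r` such that `w` has no right special factor
of length `r`. -/
noncomputable def R (w : List A) : ℕ :=
  sInf {r : ℕ | 0 < r ∧ ∀ u : List A, u.length = r → ¬ RightSpecial w u}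

/-- The number of occurrences of `u` as a factor of `w`. -/
def occCount (w u : List A) : ℕ :=
  ((Finset.range (w.length + 1)).filter
    (fun i => i + u.length ≤ w.length ∧ (w.drop i).take u.length = u)).card

/-- `K w`: the length of the shortest suffix of `w` occurring exactly once in `w`. -/
noncomputable def K (w : List A) : ℕ :=
  sInf {k : ℕ | ∃ u : List A, u <:+ w ∧ u.length = k ∧ occCount w u = 1}

/-- Left-valence of `u` in `w`. -/
def leftValence (w u : List A) : ℕ := ((Alph w).filter (fun x => x :: u <:+: w)).card

/-- `u` is a left special factor of `w`. -/
def LeftSpecial (w u : List A) : Prop := u <:+: w ∧ 2 ≤ leftValence w u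

/-- `L w`: the smallest positive integer `ℓ` such that `w` has no left special factor
of length `ℓ`. -/
noncomputable def L (w : List A) : ℕ :=
  sInf {r : ℕ | 0 < r ∧ ∀ u : List A, u.length = r → ¬ LeftSpecial w u}

/-- `H w`: the length of the shortest prefix of `w` occurring exactly once in `w`. -/
noncomputable def H (w : List A) : ℕ :=
  sInf {k : ℕ | ∃ u : List A, u <+: w ∧ u.length = k ∧ occCount w u = 1}

/-- A generalized trapezoidal word. -/
def IsGT (w : List A) : Prop :=
  w ≠ [] ∧ ((Alph w).card = 1 ∨
    ∃ m M : ℕ, 0 < m ∧ m ≤ M ∧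
      (∀ i, 1 ≤ i → i ≤ m → C w i = (Alph w).card + i - 1) ∧
      (∀ i, m ≤ i → i ≤ M - 1 → C w (i + 1) = C w i) ∧
      (∀ i, M ≤ i → i ≤ w.length → C w (i + 1) = C w i - 1))

/-- The heart of a word: remove the longest prefix and longest suffix consisting of
letters that occur exactly once in the word (if some letter repeats); otherwise the
word itself. -/
def heart (w : List A) : List A :=
  if ∀ x ∈ w, w.count x = 1 then w
  else
    ((w.dropWhile (fun x => w.count x == 1)).reverse.dropWhile
      (fun x => w.count x == 1)).reverse

/-- A word is rich if it has exactly `|w| + 1` distinct palindromic factors. -/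
def Rich (w : List A) : Prop :=
  ((factors w).filter (fun u => u.reverse = u)).card = w.length + 1

/-- `p` is a period of `w`. -/
def IsPeriod (w : List A) (p : ℕ) : Prop :=
  0 < p ∧ ∀ i : ℕ, i + p < w.length → w[i]? = w[i + p]?

/-- The minimal period of `w`. -/
noncomputable def minPeriod (w : List A) : ℕ := sInf {p : ℕ | IsPeriod w p}


/-- `f` has period `d` on the interval `[s, e)`. -/
def PerOn {B : Type*} (f : ℕ → B) (s e d : ℕ) : Prop := ∀ k, s ≤ k → k + d < e → f k = f (k + d)

theorem PerOn.mul {B : Type*} {f : ℕ → B} {s e d : ℕ} (h : PerOn f s e d) (c : ℕ) :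
    ∀ k, s ≤ k → k + c * d < e → f k = f (k + c * d) := by
  induction c with
  | zero => intro k _ _; simp
  | succ c ih =>
    intro k hk hke
    have e1 : (c + 1) * d = c * d + d := by ring
    rw [e1] at hke ⊢
    rw [ih k hk (by omega), h (k + c * d) (by omega) (by omega), Nat.add_assoc]

theorem PerOn.cong {B : Type*} {f : ℕ → B} {s e d : ℕ} (h : PerOn f s e d) {k k' : ℕ}
    (hk : s ≤ k) (hk' : s ≤ k') (hke : k < e) (hke' : k' < e) (hm : k % d = k' % d) :
    f k = f k' := by
  wlog hle : k ≤ k' generalizing k k' with H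
  · exact (H hk' hk hke' hke hm.symm (by omega)).symm
  have hd : d ∣ k' - k := (Nat.modEq_iff_dvd' hle).1 hm
  obtain ⟨c, hc⟩ := hd
  have : k' = k + c * d := by rw [Nat.mul_comm, ← hc]; omega
  rw [this]
  exact h.mul c k hk (by omega)

theorem PerOn.mono {B : Type*} {f : ℕ → B} {s e s' e' d : ℕ} (h : PerOn f s e d) (h1 : s ≤ s')
    (h2 : e' ≤ e) : PerOn f s' e' d := fun k hk hke => h k (by omega) (by omega)

theorem fine_wilf {B : Type*} {f : ℕ → B} {s e : ℕ} : ∀ n d d' : ℕ, d + d' = n → 0 < d → 0 < d' →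
    s + d + d' ≤ e → PerOn f s e d → PerOn f s e d' → PerOn f s e (Nat.gcd d d') := by
  intro n
  induction n using Nat.strong_induction_on with
  | _ n ih =>
    intro d d' hn hd hd' hlen h h'
    rcases lt_trichotomy d d' with hlt | heq | hgt
    · have key : PerOn f s e (d' - d) := by
        intro k hk hke
        by_cases hc : s + d ≤ k
        · have a1 := h (k - d) (by omega) (by omega)
          have a2 := h' (k - d) (by omega) (by omega)
          rw [show k - d + d = k by omega] at a1
          rw [show k - d + d' = k + (d' - d) by omega] at a2
          rw [← a1, a2]
        · have a1 := h' k (by omega) (by omega)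
          have a2 := h (k + (d' - d)) (by omega) (by omega)
          rw [show k + (d' - d) + d = k + d' by omega] at a2
          rw [a1, a2]
      have := ih (d + (d' - d)) (by omega) d (d' - d) rfl hd (by omega) (by omega) h key
      rwa [Nat.gcd_sub_self_right hlt.le] at this
    · subst heq; simpa using h
    · have key : PerOn f s e (d - d') := by
        intro k hk hke
        by_cases hc : s + d' ≤ k
        · have a1 := h' (k - d') (by omega) (by omega)
          have a2 := h (k - d') (by omega) (by omega)
          rw [show k - d' + d' = k by omega] at a1
          rw [show k - d' + d = k + (d - d') by omega] at a2
          rw [← a1, a2]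
        · have a1 := h k (by omega) (by omega)
          have a2 := h' (k + (d - d')) (by omega) (by omega)
          rw [show k + (d - d') + d' = k + d by omega] at a2
          rw [a1, a2]
      have := ih ((d - d') + d') (by omega) (d - d') d' rfl (by omega) hd' (by omega) key h'
      rwa [Nat.gcd_sub_self_left hgt.le] at this

/-- extend a smaller period from a subinterval -/
theorem PerOn.extend {B : Type*} {f : ℕ → B} {i e s t d g : ℕ} (h : PerOn f i e d)
    (hg : PerOn f s t g) (hd : 0 < d) (his : i ≤ s) (hte : t ≤ e)
    (hlen : s + d + g ≤ t) : PerOn f i e g := by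
  intro k hk hke
  obtain ⟨k', h1, h2, h3⟩ : ∃ k', s ≤ k' ∧ k' < s + d ∧ k' % d = k % d := by
    refine ⟨s + (k + s * d - s) % d, by omega, by have := Nat.mod_lt (k + s * d - s) hd; omega, ?_⟩
    have hs : s ≤ s * d := Nat.le_mul_of_pos_right s hd
    rw [Nat.add_mod, Nat.mod_mod, ← Nat.add_mod, show s + (k + s * d - s) = k + s * d by omega]
    simp
  rw [h.cong hk (by omega) (by omega) (by omega) h3.symm, hg k' h1 (by omega)]
  exact h.cong (by omega) (by omega) (by omega) hke (by rw [Nat.add_mod, h3, ← Nat.add_mod])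

/-- pair of occurrences witnessing a right special factor of length `n` -/
def RSp {B : Type*} (f : ℕ → B) (N n i j : ℕ) : Prop :=
  i < j ∧ j + n < N ∧ (∀ k < n, f (i + k) = f (j + k)) ∧ f (i + n) ≠ f (j + n)

/-- pair of occurrences witnessing a left special factor of length `n` -/
def LSp {B : Type*} (f : ℕ → B) (N n i j : ℕ) : Prop :=
  1 ≤ i ∧ i < j ∧ j + n ≤ N ∧ (∀ k < n, f (i + k) = f (j + k)) ∧ f (i - 1) ≠ f (j - 1)

theorem RSp.per {B : Type*} {f : ℕ → B} {N n i j : ℕ} (h : RSp f N n i j) :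
    PerOn f i (j + n) (j - i) := by
  intro k hk hke
  have := h.2.2.1 (k - i) (by have := h.1; omega)
  have h1 := h.1
  rwa [show i + (k - i) = k by omega, show j + (k - i) = k + (j - i) by omega] at this

theorem LSp.per {B : Type*} {f : ℕ → B} {N n i j : ℕ} (h : LSp f N n i j) :
    PerOn f i (j + n) (j - i) := by
  intro k hk hke
  have h1 := h.2.1
  have := h.2.2.2.1 (k - i) (by omega)
  rwa [show i + (k - i) = k by omega, show j + (k - i) = k + (j - i) by omega] at this

/-- Combining a maximal right special and a maximal left special pair. -/
theorem combine {B : Type*} {f : ℕ → B} {N n i j n' i' j' : ℕ} (h : RSp f N n i j)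
    (h' : LSp f N n' i' j') (hi : 1 ≤ i) (he' : j' + n' < N) (hlen : N ≤ n + n' + 2)
    (hmax : ∀ m a b, RSp f N m a b → m ≤ n) (hmax' : ∀ m a b, LSp f N m a b → m ≤ n') :
    i = i' ∧ j = j' ∧ n = n' := by
  have hp := h.per
  have hp' := h'.per
  obtain ⟨hij, hjn, -, hne⟩ := h
  obtain ⟨hi', hij', hjn', -, hne'⟩ := h'
  obtain ⟨d, rfl⟩ : ∃ d, j = i + d := ⟨j - i, by omega⟩
  obtain ⟨d', rfl⟩ : ∃ d', j' = i' + d' := ⟨j' - i', by omega⟩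
  rw [Nat.add_sub_cancel_left] at hp hp'
  set s := max i i' with hs
  set t := min (i + d + n) (i' + d' + n') with ht
  have hst : s + d + d' ≤ t := by omega
  have hd : 0 < d := by omega
  have hd' : 0 < d' := by omega
  have hfw := fine_wilf (f := f) (s := s) (e := t) (d + d') d d' rfl hd hd' hst
    (hp.mono (by omega) (by omega)) (hp'.mono (by omega) (by omega))
  set g := Nat.gcd d d' with hg
  have hgd : g ∣ d := Nat.gcd_dvd_left _ _
  have hgd' : g ∣ d' := Nat.gcd_dvd_right _ _
  have hgp : 0 < g := Nat.gcd_pos_of_pos_left _ hd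
  have hgl : g ≤ d := Nat.le_of_dvd hd hgd
  have hgl' : g ≤ d' := Nat.le_of_dvd hd' hgd'
  have q := hp.extend hfw hd (by omega) (by omega) (by omega)
  have q' := hp'.extend hfw hd' (by omega) (by omega) (by omega)
  have hU : PerOn f (min i i') (max (i + d + n) (i' + d' + n')) g := by
    intro k hk hke
    by_cases c1 : i ≤ k ∧ k + g < i + d + n
    · exact q k c1.1 c1.2
    · exact q' k (by omega) (by omega)
  have mg : ∀ x, (x + d) % g = x % g := fun x => by
    obtain ⟨c, hc⟩ := hgd; rw [hc]; simp
  have mg' : ∀ x, (x + d') % g = x % g := fun x => by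
    obtain ⟨c, hc⟩ := hgd'; rw [hc]; simp
  have c1 : i' ≤ i := by
    by_contra hc
    apply hne'
    rw [show i' + d' - 1 = (i' - 1) + d' by omega]
    exact hU.cong (by omega) (by omega) (by omega) (by omega) (mg' _).symm
  have c2 : i' + d' + n' ≤ i + d + n := by
    by_contra hc
    apply hne
    rw [show i + d + n = (i + n) + d by omega]
    exact hU.cong (by omega) (by omega) (by omega) (by omega) (mg _).symm
  have r1 : RSp f N (i + d + n - i' - g) i' (i' + g) := by
    refine ⟨by omega, by omega, fun k hk => ?_, ?_⟩
    · rw [hU (i' + k) (by omega) (by omega)]; congr 1; omega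
    · have : f (i' + (i + d + n - i' - g)) = f (i + n) := by
        apply hU.cong (by omega) (by omega) (by omega) (by omega)
        rw [← mg (i + n), ← Nat.add_mod_right]; congr 1; omega
      rw [this, show i' + g + (i + d + n - i' - g) = i + d + n by omega]
      exact hne
  have r2 : LSp f N (i + d + n - i' - g) i' (i' + g) := by
    refine ⟨by omega, by omega, by omega, fun k hk => ?_, ?_⟩
    · rw [hU (i' + k) (by omega) (by omega)]; congr 1; omega
    · have : f (i' + g - 1) = f (i' + d' - 1) := by
        apply hU.cong (by omega) (by omega) (by omega) (by omega)
        rw [show i' + g - 1 = (i' - 1) + g by omega, show i' + d' - 1 = (i' - 1) + d' by omega,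
          mg', Nat.add_mod_right]
      rw [this]
      exact hne'
  have b1 := hmax _ _ _ r1
  have b2 := hmax' _ _ _ r2
  omega

/-- The centring argument. -/
theorem centre {B : Type*} {f : ℕ → B} {N l n i j : ℕ}
    (hbin : ∀ a b c, a < N → b < N → c < N → f a = f b ∨ f b = f c ∨ f a = f c)
    (hN : 2 * l + 2 ≤ N) (hl : 0 < l)
    (hpal : ∀ k < l, f k = f (l - 1 - k)) (hrep : ∀ k < l, f k = f (N - l + k))
    (h : RSp f N n i j) (h' : LSp f N n i j) (hn : N ≤ n + l + 2) :
    ∀ k < N, f k = f (N - 1 - k) := by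
  have hp := h.per
  obtain ⟨hij, hjn, -, hne⟩ := h
  obtain ⟨hi, -, -, -, hne'⟩ := h'
  obtain ⟨d, rfl⟩ : ∃ d, j = i + d := ⟨j - i, by omega⟩
  rw [Nat.add_sub_cancel_left] at hp
  obtain ⟨e, he⟩ : ∃ e, e = i + d + n := ⟨_, rfl⟩
  rw [← he] at hp
  have hb : f (e - d) ≠ f e := by
    rw [he, show i + d + n - d = i + n by omega]; exact hne
  have hc : f (i - 1) ≠ f (i - 1 + d) := by
    rw [show i - 1 + d = i + d - 1 by omega]; exact hne'
  have z1 : ∀ k < l, f k = f (N - 1 - k) := by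
    intro k hk
    rw [hpal k hk, hrep (l - 1 - k) (by omega)]; congr 1; omega
  have z2 : ∀ k < N, N - l ≤ k → f k = f (N - 1 - k) := by
    intro k hk hk'
    rw [z1 (N - 1 - k) (by omega)]; congr 1; omega
  have hd : 0 < d := by omega
  have hcen : e + i = N := by
    rcases lt_trichotomy (e + i) N with hlt | heq | hgt
    · exfalso
      by_cases hβ : N - l + d ≤ e
      · apply hb
        rw [z2 e (by omega) (by omega), z2 (e - d) (by omega) (by omega)]
        rw [hp (N - 1 - e) (by omega) (by omega)]; congr 1; omega
      · have hi1 : i = 1 := by omega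
        subst hi1
        apply hc
        simp only [Nat.sub_self, Nat.zero_add]
        rw [hpal 0 hl, hpal d (by omega)]
        by_cases hdl : d = l - 1
        · have := hpal 0 hl
          subst hdl
          simp only [Nat.sub_zero, Nat.sub_self] at this ⊢
          exact this.symm
        · rw [hp (l - 1 - d) (by omega) (by omega)]; congr 1; omega
    · exact heq
    · exfalso
      by_cases hα : i + d ≤ l
      · apply hc
        rw [z1 (i - 1) (by omega), z1 (i - 1 + d) (by omega)]
        rw [hp (N - 1 - (i - 1 + d)) (by omega) (by omega)]; congr 1; omega
      · have heN : e = N - 1 := by omega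
        apply hb
        have t1 : f e = f (N - l) := by
          rw [z2 e (by omega) (by omega), heN, Nat.sub_self]
          have := hrep 0 hl
          simpa using this
        have t2 : f (e - d) = f (N - l + d) := by
          have a1 := hrep (l - 1 - d) (by omega)
          have a2 := hrep d (by omega)
          rw [← a2, hpal d (by omega), a1]; congr 1; omega
        rw [t1, t2]
        by_cases hdl : d + 1 = l
        · have a1 := hrep d (by omega)
          have a2 := hrep 0 hl
          have a3 := hpal 0 hl
          rw [← a1, show d = l - 1 - 0 by omega, ← a3, a2]; rfl
        · exact (hp (N - l) (by omega) (by omega)).symm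
  have base : ∀ k < i + d, f k = f (N - 1 - k) := by
    intro k hk
    by_cases hkl : k < l
    · exact z1 k hkl
    · have hi1 : i = 1 := by omega
      have hdl : d = l := by omega
      have hkl : k = l := by omega
      subst hi1 hkl hdl
      simp only [Nat.sub_self, Nat.zero_add] at hc
      have e1 : e = N - 1 := by omega
      subst e1
      have a1 : f 0 = f (N - 1) := by simpa using z1 0 hl
      rw [← a1] at hb
      rw [show N - 1 - d = N - 1 - d from rfl]
      rcases hbin 0 d (N - 1 - d) (by omega) (by omega) (by omega) with q | q | q
      · exact absurd q hc
      · exact q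
      · exact absurd q.symm hb
  have main : ∀ k, k < e → f k = f (N - 1 - k) := by
    intro k
    induction k using Nat.strong_induction_on with
    | _ k ih =>
      intro hk
      by_cases hkb : k < i + d
      · exact base k hkb
      · have a1 := ih (k - d) (by omega) (by omega)
        have a2 := hp (k - d) (by omega) (by omega)
        have a3 := hp (N - 1 - k) (by omega) (by omega)
        rw [show k - d + d = k by omega] at a2
        rw [← a2, a1, a3]; congr 1; omega
  intro k hk
  by_cases hke : k < e
  · exact main k hke
  · exact z2 k hk (by omega)

theorem card_le_image_succ {X Y : Type*} [DecidableEq X] [DecidableEq Y] (T : Finset Y) (π : Y → X)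
    (hu : ∀ a ∈ T, ∀ b ∈ T, ∀ c ∈ T, ∀ d ∈ T, a ≠ b → π a = π b → c ≠ d → π c = π d → π a = π c)
    (h3 : ∀ a ∈ T, ∀ b ∈ T, ∀ c ∈ T, π a = π b → π b = π c → a = b ∨ b = c ∨ a = c) :
    T.card ≤ (T.image π).card + 1 := by
  by_cases hinj : Set.InjOn π T
  · rw [Finset.card_image_of_injOn hinj]; omega
  · simp only [Set.InjOn, not_forall] at hinj
    obtain ⟨a, ha, b, hb, hab, hne⟩ := hinj
    have ha : a ∈ T := ha
    have hb : b ∈ T := hb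
    have h1 : Set.InjOn π (T.erase b : Finset Y) := by
      intro c hc d hd hcd
      by_contra hcd'
      rw [Finset.mem_coe, Finset.mem_erase] at hc hd
      have := hu a ha b hb c hc.2 d hd.2 hne hab hcd' hcd
      rcases h3 b hb c hc.2 d hd.2 (by rw [← hab, this]) hcd with q | q | q
      · exact hc.1 q.symm
      · exact hcd' q
      · exact hd.1 q.symm
    have h2 := Finset.card_le_card (Finset.image_subset_image (f := π) (Finset.erase_subset b T))
    rw [Finset.card_image_of_injOn h1, Finset.card_erase_of_mem hb] at h2
    omega

/-- window of length `n` at position `i` -/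
def win {B : Type*} (f : ℕ → B) (n i : ℕ) : List B := (List.range n).map (fun k => f (i + k))

theorem win_eq_iff {B : Type*} {f : ℕ → B} {n i j : ℕ} :
    win f n i = win f n j ↔ ∀ k < n, f (i + k) = f (j + k) := by
  simp [win]

theorem win_succ {B : Type*} (f : ℕ → B) (n i : ℕ) : (win f (n + 1) i).dropLast = win f n i := by
  simp [win, List.range_succ]

def RSU {B : Type*} (f : ℕ → B) (N : ℕ) : Prop :=
  ∀ n i j i' j', RSp f N n i j → RSp f N n i' j' → ∀ k < n, f (i + k) = f (i' + k)

def LSU {B : Type*} (f : ℕ → B) (N : ℕ) : Prop :=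
  ∀ n i j i' j', LSp f N n i j → LSp f N n i' j' → ∀ k < n, f (i + k) = f (i' + k)

def Bin {B : Type*} (f : ℕ → B) (N : ℕ) : Prop :=
  ∀ a b c, a < N → b < N → c < N → f a = f b ∨ f b = f c ∨ f a = f c

theorem exists_RSp {B : Type*} {f : ℕ → B} {N l : ℕ} (hbin : Bin f N) (hR : RSU f N)
    (hs : ∀ k < N, f k ≠ f N) (hN : 2 * l + 2 ≤ N)
    (hrep : ∀ k < l, f k = f (N - l + k))
    (hocc : ∀ i, i + l ≤ N → (∀ k < l, f (i + k) = f k) → i = 0 ∨ i = N - l) :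
    ∃ n i j, RSp f N n i j ∧ N ≤ n + l + 2 := by
  classical
  by_contra hcon
  push Not at hcon
  have br : ∀ n i j, i < j → j < N - l → (∀ k < n, f (i + k) = f (j + k)) →
      f (i + n) ≠ f (j + n) → RSp f N n i j := by
    intro n i j hij hj heq hne
    refine ⟨hij, ?_, heq, hne⟩
    by_contra hc
    rcases Nat.lt_or_ge (N - j) n with h1 | h1
    · have := heq (N - j) h1
      rw [show j + (N - j) = N by omega] at this
      exact hs _ (by omega) this
    · have hn : j + n = N := by omega
      have := hocc (i + n - l) (by omega) (by
        intro k hk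
        rw [hrep k hk]
        have := heq (n - l + k) (by omega)
        rw [show i + n - l + k = i + (n - l + k) by omega, this]; congr 1; omega)
      omega
  set c : ℕ → ℕ := fun n => ((Finset.range (N - l)).image (win f n)).card with hc
  have im : ∀ n, (Finset.range (N - l)).image (win f n) =
      ((Finset.range (N - l)).image (win f (n + 1))).image List.dropLast := by
    intro n
    rw [Finset.image_image]
    congr 1
    funext i
    simp [win_succ]
  have brw : ∀ n i j, i < N - l → j < N - l → win f n i = win f n j →
      win f (n + 1) i ≠ win f (n + 1) j → f (i + n) ≠ f (j + n) := by
    intro n i j hi hj h1 h2 h3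
    apply h2
    rw [win_eq_iff] at h1 ⊢
    intro k hk
    rcases Nat.lt_succ_iff_lt_or_eq.1 hk with h | h
    · exact h1 k h
    · rw [h]; exact h3
  have brw2 : ∀ n i j, i < N - l → j < N - l → win f n i = win f n j →
      win f (n + 1) i ≠ win f (n + 1) j → ∃ i' j', RSp f N n i' j' ∧ win f n i' = win f n i ∧
        i + n < N ∧ j + n < N := by
    intro n i j hi hj h1 h2
    have h3 := brw n i j hi hj h1 h2
    rcases lt_trichotomy i j with h | h | h
    · have := br n i j h hj (win_eq_iff.1 h1) h3
      exact ⟨i, j, this, rfl, by have := this.2.1; omega, this.2.1⟩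
    · exact absurd (by rw [h]) h3
    · have := br n j i h hi (win_eq_iff.1 h1.symm) h3.symm
      exact ⟨j, i, this, h1.symm, this.2.1, by have := this.2.1; omega⟩
  have step : ∀ n, c (n + 1) ≤ c n + 1 := by
    intro n
    simp only [hc]
    rw [im n]
    apply card_le_image_succ
    · simp only [Finset.forall_mem_image, Finset.mem_range, win_succ]
      intro i hi j hj i' hi' j' hj' h1 h2 h3 h4
      obtain ⟨x, y, h5, h6, -⟩ := brw2 n i j hi hj h2 h1
      obtain ⟨x', y', h5', h6', -⟩ := brw2 n i' j' hi' hj' h4 h3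
      rw [← h6, ← h6', win_eq_iff]
      exact hR _ _ _ _ _ h5 h5'
    · simp only [Finset.forall_mem_image, Finset.mem_range, win_succ]
      intro i hi j hj i' hi' h1 h2
      by_contra hcc
      push Not at hcc
      obtain ⟨c1, c2, c3⟩ := hcc
      obtain ⟨_, _, _, _, u1, u2⟩ := brw2 n i j hi hj h1 c1
      obtain ⟨_, _, _, _, u3, u4⟩ := brw2 n j i' hj hi' h2 c2
      have v1 := brw n i j hi hj h1 c1
      have v2 := brw n j i' hj hi' h2 c2
      have v3 := brw n i i' hi hi' (h1.trans h2) c3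
      rcases hbin _ _ _ u1 u2 u4 with q | q | q
      · exact v1 q
      · exact v2 q
      · exact v3 q
  have flat : ∀ n, N ≤ n + l + 2 → c (n + 1) ≤ c n := by
    intro n hn
    simp only [hc]
    rw [im n]
    refine le_of_eq (Finset.card_image_of_injOn ?_).symm
    intro a ha b hb hab
    rw [Finset.mem_coe, Finset.mem_image] at ha hb
    obtain ⟨i, hi, rfl⟩ := ha
    obtain ⟨j, hj, rfl⟩ := hb
    rw [win_succ, win_succ] at hab
    by_contra hne
    obtain ⟨x, y, h5, -⟩ := brw2 n i j (by simpa using hi) (by simpa using hj) hab hne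
    have := hcon n x y h5
    omega
  have c0 : c 0 ≤ 1 := by
    simp only [hc]
    refine Finset.card_le_one.2 ?_
    simp only [Finset.mem_image]
    rintro a ⟨x, -, rfl⟩ b ⟨y, -, rfl⟩
    simp [win]
  have cn : ∀ n, c n ≤ n + 1 := by
    intro n
    induction n with
    | zero => exact c0
    | succ n ih => have := step n; omega
  have cm : ∀ t, c (N - l - 2 + t) ≤ N - l - 1 := by
    intro t
    induction t with
    | zero => have := cn (N - l - 2); simp only [Nat.add_zero]; omega
    | succ t ih => have := flat (N - l - 2 + t) (by omega); rw [← Nat.add_assoc]; omega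
  have cN : c N = N - l := by
    simp only [hc]
    rw [Finset.card_image_of_injOn, Finset.card_range]
    have aux : ∀ i j, i < j → j < N → win f N i ≠ win f N j := by
      intro i j h hj heq
      have := win_eq_iff.1 heq (N - j) (by omega)
      rw [show j + (N - j) = N by omega] at this
      exact hs _ (by omega) this
    intro i hi j hj hij
    simp only [Finset.coe_range, Set.mem_Iio] at hi hj
    rcases lt_trichotomy i j with h | h | h
    · exact absurd hij (aux i j h (by omega))
    · exact h
    · exact absurd hij.symm (aux j i h (by omega))
  have := cm (l + 2)
  rw [show N - l - 2 + (l + 2) = N by omega] at this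
  omega

theorem exists_LSp {B : Type*} {f : ℕ → B} {N l : ℕ} (hbin : Bin f N) (hL : LSU f N)
    (hs : ∀ k < N, f k ≠ f N) (hN : 2 * l + 2 ≤ N)
    (hpal : ∀ k < l, f k = f (l - 1 - k))
    (hrep : ∀ k < l, f k = f (N - l + k))
    (hocc : ∀ i, i + l ≤ N → (∀ k < l, f (i + k) = f k) → i = 0 ∨ i = N - l) :
    ∃ n i j, LSp f N n i j ∧ N ≤ n + l + 2 := by
  obtain ⟨g, hg⟩ : ∃ g : ℕ → B, g = fun k => if k < N then f (N - 1 - k) else f N := ⟨_, rfl⟩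
  have g1 : ∀ k < N, g k = f (N - 1 - k) := by intro k hk; simp [hg, hk]
  have gN : g N = f N := by simp [hg]
  have tr : ∀ n i j, RSp g N n i j → LSp f N n (N - j - n) (N - i - n) := by
    rintro n i j ⟨h1, h2, h3, h4⟩
    refine ⟨by omega, by omega, by omega, ?_, ?_⟩
    · intro k hk
      have := h3 (n - 1 - k) (by omega)
      rw [g1 _ (by omega), g1 _ (by omega)] at this
      rw [show N - j - n + k = N - 1 - (j + (n - 1 - k)) by omega, ← this]; congr 1; omega
    · rw [g1 _ (by omega), g1 _ (by omega)] at h4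
      rw [show N - j - n - 1 = N - 1 - (j + n) by omega,
        show N - i - n - 1 = N - 1 - (i + n) by omega]
      exact h4.symm
  have zone : ∀ k < l, g k = f k := by
    intro k hk
    rw [g1 k (by omega), hpal k hk, hrep (l - 1 - k) (by omega)]; congr 1; omega
  obtain ⟨n, i, j, h1, h2⟩ := exists_RSp (f := g) (N := N) (l := l) (by
      intro a b c ha hb hc
      rw [g1 a ha, g1 b hb, g1 c hc]
      exact hbin _ _ _ (by omega) (by omega) (by omega)) (by
      intro n i j i' j' h h' k hk
      have := hL _ _ _ _ _ (tr _ _ _ h) (tr _ _ _ h')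
      have e1 := (tr _ _ _ h).2.2.2.1
      have e2 := (tr _ _ _ h').2.2.2.1
      obtain ⟨a1, a2, -, -⟩ := h
      obtain ⟨b1, b2, -, -⟩ := h'
      have q := this (n - 1 - k) (by omega)
      have q1 := e1 (n - 1 - k) (by omega)
      have q2 := e2 (n - 1 - k) (by omega)
      rw [g1 _ (by omega), g1 _ (by omega)]
      rw [q1, q2] at q
      rw [show N - 1 - (i + k) = N - i - n + (n - 1 - k) by omega, q]; congr 1; omega)
    (by intro k hk; rw [g1 k hk, gN]; exact hs _ (by omega)) hN
    (by
      intro k hk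
      rw [zone k hk, g1 _ (by omega), hpal k hk]; congr 1; omega)
    (by
      intro i hi h
      have := hocc (N - l - i) (by omega) (by
        intro k hk
        have := h (l - 1 - k) (by omega)
        rw [zone (l - 1 - k) (by omega), g1 _ (by omega), ← hpal k hk] at this
        rw [← this]; congr 1; omega)
      omega)
  exact ⟨n, _, _, tr _ _ _ h1, h2⟩

theorem main_comb {B : Type*} {f : ℕ → B} {N l : ℕ} (hbin : Bin f N) (hR : RSU f N) (hL : LSU f N)
    (hs : ∀ k < N, f k ≠ f N) (hl : 0 < l) (hlN : l < N)
    (hpal : ∀ k < l, f k = f (l - 1 - k))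
    (hrep : ∀ k < l, f k = f (N - l + k))
    (hocc : ∀ i, i + l ≤ N → (∀ k < l, f (i + k) = f k) → i = 0 ∨ i = N - l) :
    ∀ k < N, f k = f (N - 1 - k) := by
  classical
  have z1 : ∀ k < l, f k = f (N - 1 - k) := by
    intro k hk
    rw [hpal k hk, hrep (l - 1 - k) (by omega)]; congr 1; omega
  have z2 : ∀ k < N, N - l ≤ k → f k = f (N - 1 - k) := by
    intro k hk hk'
    rw [z1 (N - 1 - k) (by omega)]; congr 1; omega
  by_cases hN : 2 * l + 2 ≤ N
  swap
  · intro k hk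
    by_cases h1 : k < l
    · exact z1 k h1
    · by_cases h2 : N - l ≤ k
      · exact z2 k hk h2
      · congr 1; omega
  obtain ⟨n₀, i₀, j₀, h₀, hn₀⟩ := exists_RSp hbin hR hs hN hrep hocc
  obtain ⟨n₁, i₁, j₁, h₁, hn₁⟩ := exists_LSp hbin hL hs hN hpal hrep hocc
  have pick : ∀ (P : ℕ → Prop) (n : ℕ), P n → (∀ m, P m → m ≤ N) →
      ∃ m, P m ∧ n ≤ m ∧ ∀ m', P m' → m' ≤ m := by
    intro P n hn hP
    exact ⟨Nat.findGreatest P N, Nat.findGreatest_spec (hP n hn) hn,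
      Nat.le_findGreatest (hP n hn) hn, fun m' hm' => Nat.le_findGreatest (hP m' hm') hm'⟩
  obtain ⟨n, ⟨i, j, h⟩, hn, hmax⟩ := pick (fun n => ∃ i j, RSp f N n i j) n₀ ⟨i₀, j₀, h₀⟩ (by
    rintro m ⟨a, b, q⟩; have := q.2.1; omega)
  obtain ⟨n', ⟨i', j', h'⟩, hn', hmax'⟩ := pick (fun n => ∃ i j, LSp f N n i j) n₁ ⟨i₁, j₁, h₁⟩ (by
    rintro m ⟨a, b, q⟩; have := q.2.2.1; omega)
  have hi : 1 ≤ i := by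
    by_contra hc
    have hi0 : i = 0 := by omega
    subst hi0
    obtain ⟨q1, q2, q3, q4⟩ := h
    have := hocc j (by omega) (by
      intro k hk
      have := q3 k (by omega)
      rw [← this]; congr 1; omega)
    omega
  have he : j' + n' < N := by
    by_contra hc
    obtain ⟨q0, q1, q2, q3, q4⟩ := h'
    have := hocc (i' + n' - l) (by omega) (by
      intro k hk
      have := q3 (n' - l + k) (by omega)
      rw [hrep k hk, show i' + n' - l + k = i' + (n' - l + k) by omega, this]; congr 1; omega)
    omega
  obtain ⟨rfl, rfl, rfl⟩ := combine h h' hi he (by omega)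
    (fun m a b q => hmax m ⟨a, b, q⟩) (fun m a b q => hmax' m ⟨a, b, q⟩)
  exact centre hbin hN hl hpal hrep h h' (by omega)

theorem mem_factors_iff (w u : List A) : u ∈ factors w ↔ u <:+: w := by
  simp only [factors, Finset.mem_image, Finset.mem_product, Finset.mem_range, Prod.exists]
  constructor
  · rintro ⟨a, b, -, rfl⟩
    exact (List.take_prefix _ _).isInfix.trans (List.drop_suffix _ _).isInfix
  · rintro ⟨s, t, rfl⟩
    refine ⟨s.length, u.length, ⟨by simp, by simp; omega⟩, ?_⟩
    simp

/-- factor of length `n` at position `i` -/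
def wd (w : List A) (n i : ℕ) : List A := (w.drop i).take n

theorem wd_eq_iff {w : List A} {n i j : ℕ} :
    wd w n i = wd w n j ↔ ∀ k < n, w[i + k]? = w[j + k]? := by
  constructor
  · intro h k hk
    have := congrArg (fun l => l[k]?) h
    simpa [wd, List.getElem?_take, hk] using this
  · intro h
    apply List.ext_getElem?
    intro k
    by_cases hk : k < n
    · simpa [wd, List.getElem?_take, hk] using h k hk
    · simp [wd, hk]

theorem wd_tail (w : List A) (n i : ℕ) : (wd w (n + 1) i).tail = wd w n (i + 1) := by
  apply List.ext_getElem?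
  intro k
  simp only [wd, List.getElem?_tail, List.getElem?_take, List.getElem?_drop]
  simp only [Nat.add_lt_add_iff_right]
  rw [show i + (k + 1) = i + 1 + k by omega]

/-- factors of length `n` -/
def fac (w : List A) (n : ℕ) : Finset (List A) := (factors w).filter (fun u => u.length = n)

theorem mem_fac (w : List A) (n : ℕ) (u : List A) :
    u ∈ fac w n ↔ ∃ i, i + n ≤ w.length ∧ wd w n i = u := by
  simp only [fac, Finset.mem_filter, mem_factors_iff]
  constructor
  · rintro ⟨⟨s, t, rfl⟩, rfl⟩
    exact ⟨s.length, by simp, by simp [wd]⟩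
  · rintro ⟨i, hi, rfl⟩
    refine ⟨(List.take_prefix _ _).isInfix.trans (List.drop_suffix _ _).isInfix, ?_⟩
    simp [wd]; omega

theorem C_eq (w : List A) (n : ℕ) : C w n = (fac w n).card := rfl

theorem card_image_add_le {X Y : Type*} [DecidableEq X] [DecidableEq Y] (T : Finset Y) (π : Y → X)
    (S : Finset X) (hS : ∀ s ∈ S, ∃ a ∈ T, ∃ b ∈ T, a ≠ b ∧ π a = s ∧ π b = s) :
    (T.image π).card + S.card ≤ T.card := by
  have hsub : S ⊆ T.image π := by
    intro s hs
    obtain ⟨a, ha, -, -, -, h, -⟩ := hS s hs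
    exact Finset.mem_image.2 ⟨a, ha, h⟩
  rw [Finset.card_eq_sum_card_image π T]
  have e1 : (T.image π).card + S.card = ∑ x ∈ T.image π, (1 + if x ∈ S then 1 else 0) := by
    rw [Finset.sum_add_distrib, Finset.sum_ite_mem, Finset.inter_eq_right.2 hsub]
    simp
  rw [e1]
  apply Finset.sum_le_sum
  intro x hx
  split_ifs with hxS
  · obtain ⟨a, ha, b, hb, hab, h1, h2⟩ := hS x hxS
    exact Finset.one_lt_card.2 ⟨a, by simp [ha, h1], b, by simp [hb, h2], hab⟩
  · obtain ⟨a, ha, h1⟩ := Finset.mem_image.1 hx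
    exact Finset.card_pos.2 ⟨a, by simp [ha, h1]⟩

theorem LS_bound (w : List A) (n : ℕ) (hC : C w (n + 1) ≤ C w n + 1) (S : Finset (List A))
    (hS : ∀ u ∈ S, ∃ i j, LSp (fun k => w[k]?) w.length n i j ∧ wd w n i = u) :
    S.card ≤ 2 ∧ ((∃ t, 0 < t ∧ t + n ≤ w.length ∧ wd w n 0 = wd w n t) → S.card ≤ 1) := by
  rw [C_eq, C_eq] at hC
  have h1 := card_image_add_le (fac w (n + 1)) List.tail S (by
    intro u hu
    obtain ⟨i, j, ⟨a1, a2, a3, a4, a5⟩, rfl⟩ := hS u hu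
    refine ⟨wd w (n + 1) (i - 1), (mem_fac _ _ _).2 ⟨i - 1, by omega, rfl⟩,
      wd w (n + 1) (j - 1), (mem_fac _ _ _).2 ⟨j - 1, by omega, rfl⟩, ?_, ?_, ?_⟩
    · intro h
      exact a5 (by simpa using wd_eq_iff.1 h 0 (by omega))
    · rw [wd_tail, Nat.sub_add_cancel a1]
    · rw [wd_tail, Nat.sub_add_cancel (by omega), eq_comm, wd_eq_iff]
      exact a4)
  constructor
  · have h2 : (fac w n).erase (wd w n 0) ⊆ (fac w (n + 1)).image List.tail := by
      intro u hu
      rw [Finset.mem_erase, mem_fac] at hu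
      obtain ⟨hne, i, hi, rfl⟩ := hu
      have hi0 : i ≠ 0 := by rintro rfl; exact hne rfl
      refine Finset.mem_image.2 ⟨wd w (n + 1) (i - 1), (mem_fac _ _ _).2 ⟨i - 1, by omega, rfl⟩, ?_⟩
      rw [wd_tail, Nat.sub_add_cancel (by omega)]
    have h3 := Finset.card_le_card h2
    have h4 := Finset.pred_card_le_card_erase (s := fac w n) (a := wd w n 0)
    omega
  · rintro ⟨t, ht, htn, heq⟩
    have h2 : fac w n ⊆ (fac w (n + 1)).image List.tail := by
      intro u hu
      rw [mem_fac] at hu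
      obtain ⟨i, hi, rfl⟩ := hu
      obtain ⟨i', hi', hin, he⟩ : ∃ i', 0 < i' ∧ i' + n ≤ w.length ∧ wd w n i = wd w n i' := by
        rcases Nat.eq_zero_or_pos i with h | h
        · subst h; exact ⟨t, ht, htn, heq⟩
        · exact ⟨i, h, hi, rfl⟩
      refine Finset.mem_image.2 ⟨wd w (n + 1) (i' - 1), (mem_fac _ _ _).2 ⟨i' - 1, by omega, rfl⟩, ?_⟩
      rw [wd_tail, Nat.sub_add_cancel (by omega), he]
    have h3 := Finset.card_le_card h2
    omega

theorem LSp_of {B : Type*} {f : ℕ → B} {N n x y : ℕ} (hx : 1 ≤ x) (hy : 1 ≤ y) (hxn : x + n ≤ N)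
    (hyn : y + n ≤ N) (h : ∀ k < n, f (x + k) = f (y + k)) (hne : f (x - 1) ≠ f (y - 1)) :
    ∃ i j, LSp f N n i j ∧ ∀ k < n, f (i + k) = f (x + k) := by
  rcases lt_trichotomy x y with q | q | q
  · exact ⟨x, y, ⟨hx, q, hyn, h, hne⟩, fun _ _ => rfl⟩
  · exact absurd (by rw [q]) hne
  · exact ⟨y, x, ⟨hy, q, hxn, fun k hk => (h k hk).symm, hne.symm⟩, fun k hk => (h k hk).symm⟩

theorem RSU_of_C (w : List A) (hC : ∀ n, 1 ≤ n → n ≤ w.length → C w (n + 1) ≤ C w n + 1)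
    (hbin : Bin (fun k => w[k]?) w.length) : RSU (fun k => w[k]?) w.length := by
  intro n
  induction n with
  | zero => intro i j i' j' _ _ k hk; omega
  | succ n ih =>
    intro i j i' j' h h'
    obtain ⟨f, hf⟩ : ∃ f : ℕ → Option A, f = fun k => w[k]? := ⟨_, rfl⟩
    have wf : ∀ {n i j : ℕ}, wd w n i = wd w n j ↔ ∀ k < n, f (i + k) = f (j + k) := by
      intro n i j; rw [hf]; exact wd_eq_iff
    have LB := LS_bound w (n + 1)
    rw [← hf] at hbin ih h h' LB ⊢
    obtain ⟨N, hN⟩ : ∃ N, N = w.length := ⟨_, rfl⟩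
    rw [← hN] at hbin ih h h' LB hC
    by_contra hcon
    obtain ⟨h1, h2, h3, h4⟩ := h
    obtain ⟨h1', h2', h3', h4'⟩ := h'
    have LB := LB (hC (n + 1) (by omega) (by omega))
    have hr : ∀ k < n, f (i + 1 + k) = f (i' + 1 + k) := by
      apply ih (i + 1) (j + 1) (i' + 1) (j' + 1)
      · refine ⟨by omega, by omega, fun k hk => ?_, ?_⟩
        · have := h3 (k + 1) (by omega)
          rwa [show i + 1 + k = i + (k + 1) by omega, show j + 1 + k = j + (k + 1) by omega]
        · rwa [show i + 1 + n = i + (n + 1) by omega, show j + 1 + n = j + (n + 1) by omega]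
      · refine ⟨by omega, by omega, fun k hk => ?_, ?_⟩
        · have := h3' (k + 1) (by omega)
          rwa [show i' + 1 + k = i' + (k + 1) by omega, show j' + 1 + k = j' + (k + 1) by omega]
        · rwa [show i' + 1 + n = i' + (n + 1) by omega, show j' + 1 + n = j' + (n + 1) by omega]
    have hrj : ∀ k < n, f (i + 1 + k) = f (j + 1 + k) := by
      intro k hk
      have := h3 (k + 1) (by omega)
      rwa [show i + 1 + k = i + (k + 1) by omega, show j + 1 + k = j + (k + 1) by omega]
    have hrj' : ∀ k < n, f (i + 1 + k) = f (j' + 1 + k) := by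
      intro k hk
      have := h3' (k + 1) (by omega)
      rw [hr k hk]
      rwa [show i' + 1 + k = i' + (k + 1) by omega, show j' + 1 + k = j' + (k + 1) by omega]
    have hii : f i ≠ f i' := by
      intro heq
      apply hcon
      intro k hk
      rcases k with _ | k
      · exact heq
      · have := hr k (by omega)
        rwa [show i + (k + 1) = i + 1 + k by omega, show i' + (k + 1) = i' + 1 + k by omega]
    have hjj : f j ≠ f i' := by
      have := h3 0 (by omega)
      simp only [Nat.add_zero] at this
      rwa [← this]
    have hij' : f j' = f i' := by
      have := h3' 0 (by omega)
      simpa only [Nat.add_zero] using this.symm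
    have ext : ∀ x ∈ [i, j], ∃ y, (∀ k < n + 1, f (x + 1 + k) = f (y + 1 + k)) ∧ f y = f i' ∧
        y + (n + 1) < N := by
      intro x hx
      have hxr : (∀ k < n, f (x + 1 + k) = f (i + 1 + k)) ∧ x + (n + 1) < N := by
        simp only [List.mem_cons, List.not_mem_nil, or_false] at hx
        rcases hx with rfl | rfl
        · exact ⟨fun _ _ => rfl, by omega⟩
        · exact ⟨fun k hk => (hrj k hk).symm, h2⟩
      rcases hbin (i' + (n + 1)) (x + (n + 1)) (j' + (n + 1)) (by omega) (by omega) (by omega)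
        with q | q | q
      · refine ⟨i', fun k hk => ?_, rfl, by omega⟩
        rcases Nat.lt_succ_iff_lt_or_eq.1 hk with c | c
        · rw [hxr.1 k c, hr k c]
        · rw [c, show x + 1 + n = x + (n + 1) by omega, show i' + 1 + n = i' + (n + 1) by omega, q]
      · refine ⟨j', fun k hk => ?_, hij', by omega⟩
        rcases Nat.lt_succ_iff_lt_or_eq.1 hk with c | c
        · rw [hxr.1 k c, hrj' k c]
        · rw [c, show x + 1 + n = x + (n + 1) by omega, show j' + 1 + n = j' + (n + 1) by omega, q]
      · exact absurd q h4'
    have ls : ∀ x ∈ [i, j], ∃ a b, LSp f N (n + 1) a b ∧ wd w (n + 1) a = wd w (n + 1) (x + 1) := by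
      intro x hx
      obtain ⟨y, y1, y2, y3⟩ := ext x hx
      have hx2 : f x ≠ f i' ∧ x + (n + 1) < N := by
        simp only [List.mem_cons, List.not_mem_nil, or_false] at hx
        rcases hx with rfl | rfl
        · exact ⟨hii, by omega⟩
        · exact ⟨hjj, h2⟩
      obtain ⟨a, b, q1, q2⟩ := LSp_of (f := f) (N := N) (n := n + 1) (x := x + 1) (y := y + 1)
        (by omega) (by omega) (by omega) (by omega) y1 (by
          simp only [Nat.add_sub_cancel]; rw [y2]; exact hx2.1)
      exact ⟨a, b, q1, wf.2 q2⟩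
    have lsi := ls i (by simp)
    have lsj := ls j (by simp)
    have hdiff : wd w (n + 1) (i + 1) ≠ wd w (n + 1) (j + 1) := by
      intro h
      have := wf.1 h n (by omega)
      rw [show i + 1 + n = i + (n + 1) by omega, show j + 1 + n = j + (n + 1) by omega] at this
      exact h4 this
    have nopre : ∀ t, 0 < t → t + (n + 1) ≤ N → wd w (n + 1) 0 ≠ wd w (n + 1) t := by
      intro t ht htn heq
      have := (LB {wd w (n + 1) (i + 1), wd w (n + 1) (j + 1)} (by
        intro u hu
        simp only [Finset.mem_insert, Finset.mem_singleton] at hu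
        rcases hu with rfl | rfl
        · exact lsi
        · exact lsj)).2 ⟨t, ht, by omega, heq⟩
      rw [Finset.card_pair hdiff] at this
      omega
    have only : ∀ a b, LSp f N (n + 1) a b → ∀ k < n, f (a + k) = f (i + 1 + k) := by
      intro a b hab
      by_contra hcc
      have n1 : wd w (n + 1) a ≠ wd w (n + 1) (i + 1) := by
        intro h; exact hcc fun k hk => wf.1 h k (by omega)
      have n2 : wd w (n + 1) a ≠ wd w (n + 1) (j + 1) := by
        intro h; apply hcc; intro k hk
        rw [hrj k hk]; exact wf.1 h k (by omega)
      have := (LB {wd w (n + 1) a, wd w (n + 1) (i + 1), wd w (n + 1) (j + 1)} (by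
        intro u hu
        simp only [Finset.mem_insert, Finset.mem_singleton] at hu
        rcases hu with rfl | rfl | rfl
        · exact ⟨a, b, hab, rfl⟩
        · exact lsi
        · exact lsj)).1
      rw [Finset.card_eq_three.2 ⟨_, _, _, n1, n2, hdiff, rfl⟩] at this
      omega
    obtain ⟨Q, hQ⟩ : ∃ Q : ℕ → Prop, Q = fun s => s + (n + 1) ≤ N ∧
      ((∀ k < n + 1, f (s + k) = f (i + k)) ∨ (∀ k < n + 1, f (s + k) = f (i' + k))) := ⟨_, rfl⟩
    have Qi : Q i := by rw [hQ]; exact ⟨by omega, Or.inl fun _ _ => rfl⟩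
    have Qi' : Q i' := by rw [hQ]; exact ⟨by omega, Or.inr fun _ _ => rfl⟩
    obtain ⟨s, hsQ, hsmin⟩ : ∃ s, Q s ∧ ∀ s' < s, ¬ Q s' := by
      classical
      exact ⟨Nat.find ⟨i, Qi⟩, Nat.find_spec ⟨i, Qi⟩, fun s' hs' => Nat.find_min ⟨i, Qi⟩ hs'⟩
    have hsi : s ≤ i := by by_contra hc; exact hsmin i (by omega) Qi
    have hsi' : s ≤ i' := by by_contra hc; exact hsmin i' (by omega) Qi'
    obtain ⟨s2, hs2, hs2N, hs2e⟩ : ∃ s2, s < s2 ∧ s2 + (n + 1) ≤ N ∧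
        ∀ k < n + 1, f (s + k) = f (s2 + k) := by
      rw [hQ] at hsQ
      rcases hsQ.2 with q | q
      · exact ⟨j, by omega, by omega, fun k hk => by rw [q k hk, h3 k hk]⟩
      · exact ⟨j', by omega, by omega, fun k hk => by rw [q k hk, h3' k hk]⟩
    have back : ∀ t, t ≤ s → ∀ k < n + 1, f (s - t + k) = f (s2 - t + k) := by
      intro t
      induction t with
      | zero => intro _; exact hs2e
      | succ t iht =>
        intro hts
        have iht := iht (by omega)
        have key : f (s - t - 1) = f (s2 - t - 1) := by
          by_contra hne
          have r := only (s - t) (s2 - t) ⟨by omega, by omega, by omega, iht, hne⟩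
          apply hsmin (s - t - 1) (by omega)
          rw [hQ]
          refine ⟨by omega, ?_⟩
          rcases hbin i (s - t - 1) i' (by omega) (by omega) (by omega) with q | q | q
          · left
            intro k hk
            rcases k with _ | k
            · exact q.symm
            · have := r k (by omega)
              rw [show s - t - 1 + (k + 1) = s - t + k by omega, this]; congr 1; omega
          · right
            intro k hk
            rcases k with _ | k
            · exact q
            · have := r k (by omega)
              rw [show s - t - 1 + (k + 1) = s - t + k by omega, this, hr k (by omega)]
              congr 1; omega
          · exact absurd q hii
        intro k hk
        rcases k with _ | k
        · exact key
        · have := iht k (by omega)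
          rw [show s - (t + 1) + (k + 1) = s - t + k by omega, this]; congr 1; omega
    refine nopre (s2 - s) (by omega) (by omega) (wf.2 ?_)
    intro k hk
    have := back s le_rfl k hk
    rwa [Nat.sub_self] at this

theorem C_reverse (w : List A) (n : ℕ) : C w.reverse n = C w n := by
  unfold C
  apply Finset.card_bij (fun u _ => u.reverse)
  · intro u hu
    simp only [Finset.mem_filter, mem_factors_iff] at hu ⊢
    obtain ⟨⟨s, t, hst⟩, hu2⟩ := hu
    refine ⟨⟨t.reverse, s.reverse, ?_⟩, by simpa using hu2⟩
    rw [← List.reverse_reverse w, ← hst]; simp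
  · intro a _ b _ h; exact List.reverse_injective h
  · intro u hu
    simp only [Finset.mem_filter, mem_factors_iff] at hu
    exact ⟨u.reverse, by simpa [mem_factors_iff] using hu, by simp⟩

theorem LSU_of_C (w : List A) (hC : ∀ n, 1 ≤ n → n ≤ w.length → C w (n + 1) ≤ C w n + 1)
    (hbin : Bin (fun k => w[k]?) w.length) : LSU (fun k => w[k]?) w.length := by
  have g1 : ∀ k < w.length, w.reverse[k]? = w[w.length - 1 - k]? := fun k hk =>
    List.getElem?_reverse hk
  have hR := RSU_of_C w.reverse (by
    intro n h1 h2; rw [C_reverse, C_reverse]; exact hC n h1 (by simpa using h2)) (by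
    intro a b c ha hb hc
    rw [List.length_reverse] at ha hb hc
    simp only [g1 a ha, g1 b hb, g1 c hc]
    exact hbin _ _ _ (by omega) (by omega) (by omega))
  rw [List.length_reverse] at hR
  obtain ⟨N, hN⟩ : ∃ N, N = w.length := ⟨_, rfl⟩
  rw [← hN] at hR g1 ⊢
  have tr : ∀ n i j, LSp (fun k => w[k]?) N n i j →
      RSp (fun k => w.reverse[k]?) N n (N - j - n) (N - i - n) := by
    rintro n i j ⟨h0, h1, h2, h3, h4⟩
    refine ⟨by omega, by omega, ?_, ?_⟩
    · intro k hk
      have := h3 (n - 1 - k) (by omega)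
      simp only at this ⊢
      rw [g1 _ (by omega), g1 _ (by omega)]
      rw [show N - 1 - (N - j - n + k) = j + (n - 1 - k) by omega, ← this]; congr 1; omega
    · simp only at h4 ⊢
      rw [g1 _ (by omega), g1 _ (by omega)]
      rw [show N - 1 - (N - j - n + n) = j - 1 by omega,
        show N - 1 - (N - i - n + n) = i - 1 by omega]
      exact h4.symm
  intro n i j i' j' h h' k hk
  have := hR _ _ _ _ _ (tr _ _ _ h) (tr _ _ _ h') (n - 1 - k) (by omega)
  obtain ⟨a0, a1, a2, a3, -⟩ := h
  obtain ⟨b0, b1, b2, b3, -⟩ := h'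
  simp only at this a3 b3 ⊢
  rw [g1 _ (by omega), g1 _ (by omega)] at this
  rw [a3 k hk, b3 k hk]
  rw [show j + k = N - 1 - (N - j - n + (n - 1 - k)) by omega, this]; congr 1; omega

/-- hereditary property -/
def PP (w : List A) : Prop :=
  Bin (fun k => w[k]?) w.length ∧ RSU (fun k => w[k]?) w.length ∧ LSU (fun k => w[k]?) w.length

theorem PP.mono_factor {u w : List A} (h : PP w) (hu : u <:+: w) : PP u := by
  obtain ⟨s, t, rfl⟩ := hu
  obtain ⟨hb, hR, hL⟩ := h
  have key : ∀ k < u.length, u[k]? = (s ++ u ++ t)[s.length + k]? := by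
    intro k hk
    rw [List.append_assoc, List.getElem?_append_right (by omega), Nat.add_sub_cancel_left,
      List.getElem?_append_left hk]
  have hlen : (s ++ u ++ t).length = s.length + u.length + t.length := by simp [Nat.add_assoc]
  obtain ⟨w, hw⟩ : ∃ w, w = s ++ u ++ t := ⟨_, rfl⟩
  rw [← hw] at hb hR hL key hlen
  refine ⟨?_, ?_, ?_⟩
  · intro a b c ha hb' hc
    simp only
    rw [key a ha, key b hb', key c hc]
    exact hb _ _ _ (by omega) (by omega) (by omega)
  · have tr : ∀ n i j, RSp (fun k => u[k]?) u.length n i j →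
        RSp (fun k => w[k]?) w.length n (s.length + i) (s.length + j) := by
      rintro n i j ⟨h1, h2, h3, h4⟩
      refine ⟨by omega, by omega, fun k hk => ?_, ?_⟩
      · have := h3 k hk
        simp only at this ⊢
        rw [key _ (by omega), key _ (by omega)] at this
        simpa only [Nat.add_assoc] using this
      · simp only at h4 ⊢
        rw [key _ (by omega), key _ (by omega)] at h4
        simpa only [Nat.add_assoc] using h4
    intro n i j i' j' h h' k hk
    have := hR _ _ _ _ _ (tr _ _ _ h) (tr _ _ _ h') k hk
    have q1 := h.2.1
    have q2 := h'.2.1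
    have q3 := h.1
    have q4 := h'.1
    simp only at this ⊢
    rw [key _ (by omega), key _ (by omega)]
    simpa only [Nat.add_assoc] using this
  · have tr : ∀ n i j, LSp (fun k => u[k]?) u.length n i j →
        LSp (fun k => w[k]?) w.length n (s.length + i) (s.length + j) := by
      rintro n i j ⟨h0, h1, h2, h3, h4⟩
      refine ⟨by omega, by omega, by omega, fun k hk => ?_, ?_⟩
      · have := h3 k hk
        simp only at this ⊢
        rw [key _ (by omega), key _ (by omega)] at this
        simpa only [Nat.add_assoc] using this
      · simp only at h4 ⊢
        rw [key _ (by omega), key _ (by omega)] at h4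
        rwa [show s.length + i - 1 = s.length + (i - 1) by omega,
          show s.length + j - 1 = s.length + (j - 1) by omega]
    intro n i j i' j' h h' k hk
    have := hL _ _ _ _ _ (tr _ _ _ h) (tr _ _ _ h') k hk
    have q1 := h.2.2.1
    have q2 := h'.2.2.1
    have q3 := h.2.1
    have q4 := h'.2.1
    simp only at this ⊢
    rw [key _ (by omega), key _ (by omega)]
    simpa only [Nat.add_assoc] using this

theorem reverse_eq_of_getElem {v : List A}
    (h : ∀ k < v.length, v[k]? = v[v.length - 1 - k]?) : v.reverse = v := by
  apply List.ext_getElem?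
  intro k
  by_cases hk : k < v.length
  · rw [List.getElem?_reverse hk, ← h k hk]
  · rw [List.getElem?_eq_none (by simpa using hk), List.getElem?_eq_none (by omega)]

theorem longest_uni {W p : List A} (hP : PP W) (hp0 : p ≠ []) (hpal : p.reverse = p)
    (hsuf : p <:+ W)
    (hlong : ∀ u, u <:+ W → u.reverse = u → u.length ≤ p.length) :
    ∀ b, b + p.length < W.length → wd W p.length b ≠ p := by
  intro b₀ hb₀ hwb₀
  obtain ⟨l, hl⟩ : ∃ l, l = p.length := ⟨_, rfl⟩
  obtain ⟨b, ⟨hb, hwb⟩, hbmax⟩ : ∃ b, (b + l < W.length ∧ wd W l b = p) ∧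
      ∀ b', (b' + l < W.length ∧ wd W l b' = p) → b' ≤ b := by
    classical
    rw [← hl] at hb₀ hwb₀
    exact ⟨Nat.findGreatest (fun b => b + l < W.length ∧ wd W l b = p) W.length,
      Nat.findGreatest_spec (P := fun b => b + l < W.length ∧ wd W l b = p) (m := b₀)
        (by omega) ⟨hb₀, hwb₀⟩,
      fun b' hb' => Nat.le_findGreatest (by have := hb'.1; omega) hb'⟩
  have hlp : 0 < l := by rw [hl]; exact List.length_pos_iff.2 hp0
  obtain ⟨v, hv⟩ : ∃ v, v = W.drop b := ⟨_, rfl⟩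
  have hvs : v <:+ W := by rw [hv]; exact List.drop_suffix _ _
  have hvl : v.length = W.length - b := by rw [hv]; simp
  have hvget : ∀ k, v[k]? = W[b + k]? := by intro k; rw [hv]; simp
  have hPv := hP.mono_factor hvs.isInfix
  have hpv : ∀ k < l, v[k]? = p[k]? := by
    intro k hk
    rw [hvget, ← hwb]; simp [wd, hk]
  have hpe : ∀ k < l, p[k]? = v[v.length - l + k]? := by
    intro k hk
    obtain ⟨t, ht⟩ := hsuf
    rw [hvget, ← ht, hvl, ← ht]
    rw [List.getElem?_append_right (by simp; omega)]
    congr 1; simp [hl]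
    have : t.length + p.length = W.length := by rw [← ht]; simp
    omega
  have hvp := main_comb (f := fun k => v[k]?) (N := v.length) (l := l) hPv.1 hPv.2.1 hPv.2.2
    (by intro k hk; simp [hk]) hlp (by omega)
    (by
      intro k hk
      rw [hpv k hk, hpv _ (by omega)]
      conv_lhs => rw [← hpal]
      rw [List.getElem?_reverse (by omega), hl])
    (by
      intro k hk
      rw [hpv k hk, hpe k hk])
    (by
      intro i hi h
      by_contra hc
      push Not at hc
      have := hbmax (b + i) ⟨by omega, by
        rw [← hwb, wd_eq_iff]
        intro k hk
        rw [Nat.add_assoc, ← hvget, ← hvget]; exact h k hk⟩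
      omega)
  have := hlong v hvs (reverse_eq_of_getElem hvp)
  omega

theorem rich_of_PP (w : List A) : PP w → Rich w := by
  induction w using List.reverseRecOn with
  | nil => intro _; simp [Rich, factors, Finset.filter_singleton]
  | append_singleton w c ih =>
    intro hP
    have ih := ih (hP.mono_factor (List.prefix_append _ _).isInfix)
    obtain ⟨p, ⟨hsuf, hpal⟩, hlong⟩ : ∃ p, (p <:+ w ++ [c] ∧ p.reverse = p) ∧
        ∀ u, u <:+ w ++ [c] → u.reverse = u → u.length ≤ p.length := by
      classical
      have hmem : ∀ u, u ∈ ((w ++ [c]).tails.filter (fun u => u.reverse = u)).toFinset ↔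
          u <:+ w ++ [c] ∧ u.reverse = u := by
        intro u
        rw [List.mem_toFinset, List.mem_filter, List.mem_tails, decide_eq_true_eq]
      have hfin : ((w ++ [c]).tails.filter (fun u => u.reverse = u)).toFinset.Nonempty :=
        ⟨[], (hmem _).2 ⟨List.nil_suffix, rfl⟩⟩
      obtain ⟨p, hp, hmax⟩ := Finset.exists_max_image _ List.length hfin
      refine ⟨p, (hmem _).1 hp, fun u h1 h2 => hmax u ((hmem _).2 ⟨h1, h2⟩)⟩
    have hp0 : p ≠ [] := by
      rintro rfl
      have := hlong [c] (List.suffix_append _ _) rfl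
      simp at this
    have huni := longest_uni hP hp0 hpal hsuf hlong
    have hnot : ¬ p <:+: w := by
      rintro ⟨s, t, hst⟩
      apply huni s.length
      · rw [← hst]; simp
      · rw [← hst]; simp [wd]
    have hset : (factors (w ++ [c])).filter (fun u => u.reverse = u) =
        insert p ((factors w).filter (fun u => u.reverse = u)) := by
      ext u
      simp only [Finset.mem_filter, Finset.mem_insert, mem_factors_iff, List.infix_concat_iff]
      constructor
      · rintro ⟨h1 | h1, h2⟩
        · by_cases hup : u = p
          · exact Or.inl hup
          · right
            refine ⟨?_, h2⟩
            have h3 := hlong u h1 h2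
            have h4 : u <:+ p := List.suffix_of_suffix_length_le h1 hsuf h3
            have h5 : u <+: p := by
              rw [← hpal, ← h2]; exact List.reverse_prefix.2 h4
            obtain ⟨r, hr⟩ := h5
            obtain ⟨s, hs⟩ := hsuf
            rcases List.eq_nil_or_concat r with rfl | ⟨r', x, rfl⟩
            · exact absurd (by simpa using hr) hup
            · have : s ++ u ++ r' ++ [x] = w ++ [c] := by
                rw [← hs, ← hr]; simp
              have := (List.append_inj' this rfl).1
              exact ⟨s, r', this⟩
        · exact Or.inr ⟨h1, h2⟩
      · rintro (rfl | ⟨h1, h2⟩)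
        · exact ⟨Or.inl hsuf, hpal⟩
        · exact ⟨Or.inr h1, h2⟩
    unfold Rich at ih ⊢
    rw [hset, Finset.card_insert_of_notMem, ih]
    · simp
    · simp [mem_factors_iff, hnot]

theorem stmt14 (w : List A) (hw : IsGT w) (h2 : (Alph w).card = 2) : Rich w := by
  obtain ⟨-, h | ⟨m, M, hm, hmM, h3, h4, h5⟩⟩ := hw
  · omega
  have hC : ∀ n, 1 ≤ n → n ≤ w.length → C w (n + 1) ≤ C w n + 1 := by
    intro n h1 hn
    rcases Nat.lt_or_ge n m with c | c
    · rw [h3 n h1 (by omega), h3 (n + 1) (by omega) (by omega)]; omega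
    · rcases Nat.lt_or_ge n M with c' | c'
      · rw [h4 n c (by omega)]; omega
      · rw [h5 n c' hn]; omega
  have hbin : Bin (fun k => w[k]?) w.length := by
    intro a b c ha hb hc
    simp only
    rw [List.getElem?_eq_getElem ha, List.getElem?_eq_getElem hb, List.getElem?_eq_getElem hc]
    by_contra hcon
    push Not at hcon
    obtain ⟨q1, q2, q3⟩ := hcon
    have : ({w[a], w[b], w[c]} : Finset A) ⊆ Alph w := by
      intro x hx
      simp only [Finset.mem_insert, Finset.mem_singleton] at hx
      simp only [Alph, List.mem_toFinset]
      rcases hx with rfl | rfl | rfl <;> exact List.getElem_mem _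
    have := Finset.card_le_card this
    rw [Finset.card_eq_three.2 ⟨_, _, _, fun h => q1 (by rw [h]), fun h => q3 (by rw [h]),
      fun h => q2 (by rw [h]), rfl⟩] at this
    omega
  exact rich_of_PP w ⟨hbin, RSU_of_C w hC hbin, LSU_of_C w hC hbin⟩
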